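/- A non-empty bicategory B is pseudofiltered if and only if B satisfies the three axioms (0-pFlt), (1-pFlt) and (2-pFlt). -/

import Mathlib

open CategoryTheory Bicategory

universe w v u w' v' u'

namespace Paper

/-- A pseudo-cocone of a pseudofunctor `F : C ⥤ B` with apex `E : B`. -/
structure PseudoCocone {C : Type u'} [Bicategory.{w', v'} C] {B : Type u} [Bicategory.{w, v} B]
    (F : Pseudofunctor C B) (E : B) where
  app (A : C) : F.obj A ⟶ E
  nat {A A' : C} (f : A ⟶ A') : F.map f ≫ app A' ≅ app A
  unity (A : C) :
    (nat (𝟙 A)).hom = ((F.mapId A).hom ▷ app A) ≫ (λ_ (app A)).hom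
  comp {A A' A'' : C} (f : A ⟶ A') (g : A' ⟶ A'') :
    (nat (f ≫ g)).hom =
      ((F.mapComp f g).hom ▷ app A'') ≫ (α_ (F.map f) (F.map g) (app A'')).hom ≫
        (F.map f ◁ (nat g).hom) ≫ (nat f).hom
  nat2 {A A' : C} {f g : A ⟶ A'} (γ : f ⟶ g) :
    (F.map₂ γ ▷ app A') ≫ (nat g).hom = (nat f).hom

/-- A bicategory is finite if it has finitely many objects, 1-cells and 2-cells. -/
def FiniteBicategory (C : Type u') [Bicategory.{w', v'} C] : Prop :=
  Finite C ∧ (∀ a b : C, Finite (a ⟶ b)) ∧ ∀ (a b : C) (f g : a ⟶ b), Finite (f ⟶ g)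

/-- A bicategory is connected if any two of its objects can be joined by a finite zigzag of
1-cells. -/
def ConnectedBicategory (C : Type u') [Bicategory.{w', v'} C] : Prop :=
  ∀ a b : C, Relation.ReflTransGen (fun x y : C => Nonempty (x ⟶ y) ∨ Nonempty (y ⟶ x)) a b

/-- A (non-empty) bicategory is pseudofiltered if every pseudofunctor from a finite connected
bicategory admits a pseudo-cocone. -/
def IsPseudofiltered (B : Type u) [Bicategory.{w, v} B] : Prop :=
  ∀ (C : Type u') [Bicategory.{w', v'} C], FiniteBicategory C → ConnectedBicategory C →
    ∀ F : Pseudofunctor C B, ∃ E : B, Nonempty (PseudoCocone F E)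

/-- Axiom (0-pFlt). -/
def PFlt0 (B : Type u) [Bicategory.{w, v} B] : Prop :=
  ∀ ⦃A B' C : B⦄ (_ : C ⟶ A) (_ : C ⟶ B'), ∃ (D : B) (_ : A ⟶ D) (_ : B' ⟶ D), True

/-- Axiom (1-pFlt). -/
def PFlt1 (B : Type u) [Bicategory.{w, v} B] : Prop :=
  ∀ ⦃A B' : B⦄ (f g : A ⟶ B'), ∃ (C : B) (u : B' ⟶ C) (_ : f ≫ u ⟶ g ≫ u), True

/-- Axiom (2-pFlt). -/
def PFlt2 (B : Type u) [Bicategory.{w, v} B] : Prop :=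
  ∀ ⦃A B' : B⦄ (f g : A ⟶ B') (α β : f ⟶ g), ∃ (C : B) (u : B' ⟶ C), α ▷ u = β ▷ u

/-- Finite-family principle. -/
theorem exists_all_of_finite {X : Type*} {ι : Type*} [Finite ι] (x₀ : X) (step : X → X → Prop)
    (Q : ι → X → Prop) (hst : ∀ i x y, step x y → Q i x → Q i y)
    (hat : ∀ i x, ∃ y, step x y ∧ Q i y) (R : X → Prop) (hR : ∀ x y, step x y → R x → R y)
    (h₀ : R x₀) : ∃ x, R x ∧ ∀ i, Q i x := by
  classical
  have := Fintype.ofFinite ι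
  have key : ∀ s : Finset ι, ∃ x, R x ∧ ∀ i ∈ s, Q i x := by
    intro s
    induction s using Finset.induction_on with
    | empty => exact ⟨x₀, h₀, by simp⟩
    | insert j s hj ih =>
      obtain ⟨x, hx, hs⟩ := ih
      obtain ⟨y, hxy, hy⟩ := hat j x
      refine ⟨y, hR _ _ hxy hx, fun i hi => ?_⟩
      rcases Finset.mem_insert.1 hi with rfl | hi
      · exact hy
      · exact hst _ _ _ hxy (hs i hi)
  obtain ⟨x, hx, h⟩ := key Finset.univ
  exact ⟨x, hx, fun i => h i (Finset.mem_univ i)⟩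

section Forward

variable {C : Type u'} [Bicategory.{w', v'} C] {B : Type u} [Bicategory.{w, v} B]

theorem exists_iso (h1 : PFlt1 B) (h2 : PFlt2 B) {X Y : B} (f g : X ⟶ Y) :
    ∃ (E : B) (u : Y ⟶ E), Nonempty (f ≫ u ≅ g ≫ u) := by
  obtain ⟨D, p, a, -⟩ := h1 f g
  obtain ⟨D', q, b, -⟩ := h1 (g ≫ p) (f ≫ p)
  obtain ⟨D₁, r, hr⟩ := h2 _ _ (a ▷ q ≫ b) (𝟙 _)
  obtain ⟨D₂, t, ht⟩ := h2 _ _ ((b ≫ a ▷ q) ▷ r) (𝟙 _)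
  have hr' := congrArg (fun z => z ▷ t) hr
  let i : (((f ≫ p) ≫ q) ≫ r) ≫ t ≅ (((g ≫ p) ≫ q) ≫ r) ≫ t :=
    { hom := ((a ▷ q) ▷ r) ▷ t
      inv := (b ▷ r) ▷ t
      hom_inv_id := by simpa only [comp_whiskerRight, id_whiskerRight] using hr'
      inv_hom_id := by simpa only [comp_whiskerRight, id_whiskerRight] using ht }
  exact ⟨D₂, p ≫ q ≫ r ≫ t, ⟨(α_ _ _ _).symm ≪≫ (α_ _ _ _).symm ≪≫ (α_ _ _ _).symm ≪≫ i ≪≫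
    α_ _ _ _ ≪≫ α_ _ _ _ ≪≫ α_ _ _ _⟩⟩

/-- A family of 1-cells to a common apex. -/
structure Leg (F : Pseudofunctor C B) where
  apex : B
  app (A : C) : F.obj A ⟶ apex

/-- The data of a pseudo-cocone, without axioms. -/
structure PreCocone (F : Pseudofunctor C B) where
  apex : B
  app (A : C) : F.obj A ⟶ apex
  nat {A A' : C} (f : A ⟶ A') : F.map f ≫ app A' ≅ app A

variable {F : Pseudofunctor C B}

def Leg.post (P : Leg F) {E : B} (u : P.apex ⟶ E) : Leg F := ⟨E, fun A => P.app A ≫ u⟩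

def PreCocone.post (P : PreCocone F) {E : B} (u : P.apex ⟶ E) : PreCocone F where
  apex := E
  app A := P.app A ≫ u
  nat f := (α_ _ _ _).symm ≪≫ whiskerRightIso (P.nat f) u

theorem unity_post (P : PreCocone F) {E : B} (u : P.apex ⟶ E) (A : C)
    (h : (P.nat (𝟙 A)).hom ▷ u = (((F.mapId A).hom ▷ P.app A) ≫ (λ_ (P.app A)).hom) ▷ u) :
    ((P.post u).nat (𝟙 A)).hom =
      ((F.mapId A).hom ▷ (P.post u).app A) ≫ (λ_ ((P.post u).app A)).hom := by
  change (α_ _ _ _).inv ≫ (P.nat (𝟙 A)).hom ▷ u =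
    (F.mapId A).hom ▷ (P.app A ≫ u) ≫ (λ_ (P.app A ≫ u)).hom
  rw [h]
  simp

theorem comp_post (P : PreCocone F) {E : B} (u : P.apex ⟶ E) {A A' A'' : C}
    (f : A ⟶ A') (g : A' ⟶ A'')
    (h : (P.nat (f ≫ g)).hom ▷ u =
      (((F.mapComp f g).hom ▷ P.app A'') ≫ (α_ (F.map f) (F.map g) (P.app A'')).hom ≫
        (F.map f ◁ (P.nat g).hom) ≫ (P.nat f).hom) ▷ u) :
    ((P.post u).nat (f ≫ g)).hom =
      ((F.mapComp f g).hom ▷ (P.post u).app A'') ≫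
        (α_ (F.map f) (F.map g) ((P.post u).app A'')).hom ≫
        (F.map f ◁ ((P.post u).nat g).hom) ≫ ((P.post u).nat f).hom := by
  change (α_ _ _ _).inv ≫ (P.nat (f ≫ g)).hom ▷ u =
      ((F.mapComp f g).hom ▷ (P.app A'' ≫ u)) ≫
        (α_ (F.map f) (F.map g) (P.app A'' ≫ u)).hom ≫
        (F.map f ◁ ((α_ _ _ _).inv ≫ (P.nat g).hom ▷ u)) ≫ (α_ _ _ _).inv ≫ (P.nat f).hom ▷ u
  rw [h]
  simp

theorem nat2_post (P : PreCocone F) {E : B} (u : P.apex ⟶ E) {A A' : C}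
    {f g : A ⟶ A'} (γ : f ⟶ g)
    (h : ((F.map₂ γ ▷ P.app A') ≫ (P.nat g).hom) ▷ u = (P.nat f).hom ▷ u) :
    (F.map₂ γ ▷ (P.post u).app A') ≫ ((P.post u).nat g).hom = ((P.post u).nat f).hom := by
  change F.map₂ γ ▷ (P.app A' ≫ u) ≫ (α_ _ _ _).inv ≫ (P.nat g).hom ▷ u =
    (α_ _ _ _).inv ≫ (P.nat f).hom ▷ u
  rw [← h]
  simp

theorem exists_leg (h0 : PFlt0 B) [Finite C] [Nonempty C] (hC : ConnectedBicategory C)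
    (F : Pseudofunctor C B) : Nonempty (Leg F) := by
  obtain ⟨a₀⟩ := ‹Nonempty C›
  have cosp : ∀ a : C, ∃ (D : B) (_ : F.obj a₀ ⟶ D) (_ : F.obj a ⟶ D), True := by
    intro a
    induction hC a₀ a with
    | refl => exact ⟨_, 𝟙 _, 𝟙 _, trivial⟩
    | tail _ hbc ih =>
      obtain ⟨D, p, q, -⟩ := ih
      rcases hbc with ⟨⟨f⟩⟩ | ⟨⟨f⟩⟩
      · obtain ⟨D', r, s, -⟩ := h0 q (F.map f)
        exact ⟨D', p ≫ r, s, trivial⟩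
      · exact ⟨D, p, F.map f ≫ q, trivial⟩
  obtain ⟨⟨E, hE₀⟩, -, hE⟩ := exists_all_of_finite (ι := C)
    (X := {x : B // Nonempty (F.obj a₀ ⟶ x)}) ⟨F.obj a₀, ⟨𝟙 _⟩⟩
    (fun x y => Nonempty (x.1 ⟶ y.1)) (fun a x => Nonempty (F.obj a ⟶ x.1))
    (fun a x y ⟨f⟩ ⟨g⟩ => ⟨g ≫ f⟩)
    (by
      rintro a ⟨x, ⟨p⟩⟩
      obtain ⟨D, q, r, -⟩ := cosp a
      obtain ⟨D', m, n, -⟩ := h0 p q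
      exact ⟨⟨D', ⟨p ≫ m⟩⟩, ⟨m⟩, ⟨r ≫ n⟩⟩)
    (fun _ => True) (fun _ _ _ h => h) trivial
  exact ⟨⟨E, fun a => (hE a).some⟩⟩

theorem exists_preCocone (h1 : PFlt1 B) (h2 : PFlt2 B) (hfin : FiniteBicategory C) (P : Leg F) :
    Nonempty (PreCocone F) := by
  obtain ⟨_, _, _⟩ := hfin
  obtain ⟨Q, -, hQ⟩ := exists_all_of_finite (ι := Σ (A : C) (A' : C), A ⟶ A') P
    (fun x y => ∃ (E : B) (u : x.apex ⟶ E), y = x.post u)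
    (fun i x => Nonempty (F.map i.2.2 ≫ x.app i.2.1 ≅ x.app i.1))
    (by
      rintro ⟨A, A', f⟩ x y ⟨E, u, rfl⟩ ⟨i⟩
      exact ⟨(α_ _ _ _).symm ≪≫ whiskerRightIso i u⟩)
    (by
      rintro ⟨A, A', f⟩ x
      obtain ⟨E, u, ⟨i⟩⟩ := exists_iso h1 h2 (F.map f ≫ x.app A') (x.app A)
      exact ⟨_, ⟨E, u, rfl⟩, ⟨(α_ _ _ _).symm ≪≫ i⟩⟩)
    (fun _ => True) (fun _ _ _ h => h) trivial
  exact ⟨⟨Q.apex, Q.app, fun {A A'} f => (hQ ⟨A, A', f⟩).some⟩⟩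

theorem exists_pseudoCocone (h2 : PFlt2 B) (hfin : FiniteBicategory C) (P : PreCocone F) :
    ∃ E : B, Nonempty (PseudoCocone F E) := by
  obtain ⟨_, _, hf2⟩ := hfin
  have hf2' : ∀ (a b : C) (f g : a ⟶ b), Finite (f ⟶ g) := hf2
  let step : PreCocone F → PreCocone F → Prop :=
    fun x y => ∃ (E : B) (u : x.apex ⟶ E), y = x.post u
  let U : PreCocone F → Prop := fun x => ∀ A : C,
    (x.nat (𝟙 A)).hom = ((F.mapId A).hom ▷ x.app A) ≫ (λ_ (x.app A)).hom
  let V : PreCocone F → Prop := fun x =>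
    ∀ i : (Σ (A : C) (A' : C) (A'' : C), (A ⟶ A') × (A' ⟶ A'')),
    (x.nat (i.2.2.2.1 ≫ i.2.2.2.2)).hom =
      ((F.mapComp i.2.2.2.1 i.2.2.2.2).hom ▷ x.app i.2.2.1) ≫
      (α_ (F.map i.2.2.2.1) (F.map i.2.2.2.2) (x.app i.2.2.1)).hom ≫
        (F.map i.2.2.2.1 ◁ (x.nat i.2.2.2.2).hom) ≫ (x.nat i.2.2.2.1).hom
  have hU : ∀ x y, step x y → U x → U y := by
    rintro x y ⟨E, u, rfl⟩ h A
    exact unity_post x u A (congrArg (fun z => z ▷ u) (h A))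
  have hV : ∀ x y, step x y → V x → V y := by
    rintro x y ⟨E, u, rfl⟩ h ⟨A, A', A'', f, g⟩
    exact comp_post x u f g (congrArg (fun z => z ▷ u) (h ⟨A, A', A'', f, g⟩))
  obtain ⟨Q₁, -, hQ₁⟩ := exists_all_of_finite (ι := C) P step
    (fun A x => (x.nat (𝟙 A)).hom = ((F.mapId A).hom ▷ x.app A) ≫ (λ_ (x.app A)).hom)
    (by
      rintro A x y ⟨E, u, rfl⟩ h
      exact unity_post x u A (congrArg (fun z => z ▷ u) h))
    (by
      intro A x
      obtain ⟨E, u, h⟩ := h2 _ _ (x.nat (𝟙 A)).hom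
        (((F.mapId A).hom ▷ x.app A) ≫ (λ_ (x.app A)).hom)
      exact ⟨_, ⟨E, u, rfl⟩, unity_post x u A h⟩)
    (fun _ => True) (fun _ _ _ h => h) trivial
  obtain ⟨Q₂, hUQ₂, hQ₂⟩ := exists_all_of_finite
    (ι := Σ (A : C) (A' : C) (A'' : C), (A ⟶ A') × (A' ⟶ A'')) Q₁ step
    (fun i x => (x.nat (i.2.2.2.1 ≫ i.2.2.2.2)).hom =
      ((F.mapComp i.2.2.2.1 i.2.2.2.2).hom ▷ x.app i.2.2.1) ≫
      (α_ (F.map i.2.2.2.1) (F.map i.2.2.2.2) (x.app i.2.2.1)).hom ≫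
        (F.map i.2.2.2.1 ◁ (x.nat i.2.2.2.2).hom) ≫ (x.nat i.2.2.2.1).hom)
    (by
      rintro ⟨A, A', A'', f, g⟩ x y ⟨E, u, rfl⟩ h
      exact comp_post x u f g (congrArg (fun z => z ▷ u) h))
    (by
      rintro ⟨A, A', A'', f, g⟩ x
      obtain ⟨E, u, h⟩ := h2 _ _ (x.nat (f ≫ g)).hom
        (((F.mapComp f g).hom ▷ x.app A'') ≫ (α_ (F.map f) (F.map g) (x.app A'')).hom ≫
        (F.map f ◁ (x.nat g).hom) ≫ (x.nat f).hom)
      exact ⟨_, ⟨E, u, rfl⟩, comp_post x u f g h⟩)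
    U hU hQ₁
  obtain ⟨Q₃, ⟨hUQ₃, hVQ₃⟩, hQ₃⟩ := exists_all_of_finite
    (ι := Σ (A : C) (A' : C) (f : A ⟶ A') (g : A ⟶ A'), (f ⟶ g)) Q₂ step
    (fun i x => (F.map₂ i.2.2.2.2 ▷ x.app i.2.1) ≫ (x.nat i.2.2.2.1).hom = (x.nat i.2.2.1).hom)
    (by
      rintro ⟨A, A', f, g, γ⟩ x y ⟨E, u, rfl⟩ h
      exact nat2_post x u γ (congrArg (fun z => z ▷ u) h))
    (by
      rintro ⟨A, A', f, g, γ⟩ x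
      obtain ⟨E, u, h⟩ := h2 _ _ ((F.map₂ γ ▷ x.app A') ≫ (x.nat g).hom) (x.nat f).hom
      exact ⟨_, ⟨E, u, rfl⟩, nat2_post x u γ h⟩)
    (fun x => U x ∧ V x) (fun x y h hx => ⟨hU x y h hx.1, hV x y h hx.2⟩) ⟨hUQ₂, hQ₂⟩
  exact ⟨Q₃.apex, ⟨{
    app := Q₃.app
    nat := Q₃.nat
    unity := hUQ₃
    comp := fun {A A' A''} f g => hVQ₃ ⟨A, A', A'', f, g⟩
    nat2 := fun {A A' f g} γ => hQ₃ ⟨A, A', f, g, γ⟩ }⟩⟩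

end Forward

section Backward

/-- The shape: a span-like bicategory with hom-categories `K` from `o` to `a` and to `b`. -/
inductive Shape (K : Type v') : Type u'
  | o
  | a
  | b

namespace Shape

variable (K : Type v')

def Hom : Shape.{v', u'} K → Shape.{v', u'} K → Type v'
  | o, o => PUnit
  | a, a => PUnit
  | b, b => PUnit
  | o, a => K
  | o, b => K
  | a, o => PEmpty
  | b, o => PEmpty
  | a, b => PEmpty
  | b, a => PEmpty

def unitCat : Category.{w'} PUnit.{v' + 1} where
  Hom _ _ := PUnit
  id _ := ⟨⟩
  comp _ _ := ⟨⟩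

def emptyCat : Category.{w'} PEmpty.{v' + 1} where
  Hom _ _ := PUnit
  id _ := ⟨⟩
  comp _ _ := ⟨⟩

variable [Category.{w'} K]

instance homCat : ∀ x y : Shape.{v', u'} K, Category.{w'} (Hom K x y)
  | o, o => unitCat
  | a, a => unitCat
  | b, b => unitCat
  | o, a => ‹Category K›
  | o, b => ‹Category K›
  | a, o => emptyCat
  | b, o => emptyCat
  | a, b => emptyCat
  | b, a => emptyCat

def idd : ∀ x : Shape.{v', u'} K, Hom K x x
  | o => ⟨⟩
  | a => ⟨⟩
  | b => ⟨⟩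

def cmp : ∀ {x y z : Shape.{v', u'} K}, Hom K x y → Hom K y z → Hom K x z
  | o, o, o, _, _ => ⟨⟩
  | a, a, a, _, _ => ⟨⟩
  | b, b, b, _, _ => ⟨⟩
  | o, o, a, _, k => k
  | o, o, b, _, k => k
  | o, a, a, k, _ => k
  | o, b, b, k, _ => k

def wl : ∀ {x y z : Shape.{v', u'} K} (f : Hom K x y) {g h : Hom K y z} (_ : g ⟶ h),
    cmp K f g ⟶ cmp K f h
  | o, o, o, _, _, _, _ => 𝟙 _
  | a, a, a, _, _, _, _ => 𝟙 _
  | b, b, b, _, _, _, _ => 𝟙 _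
  | o, o, a, _, _, _, k => k
  | o, o, b, _, _, _, k => k
  | o, a, a, _, _, _, _ => 𝟙 _
  | o, b, b, _, _, _, _ => 𝟙 _

def wr : ∀ {x y z : Shape.{v', u'} K} {f g : Hom K x y} (_ : f ⟶ g) (h : Hom K y z),
    cmp K f h ⟶ cmp K g h
  | o, o, o, _, _, _, _ => 𝟙 _
  | a, a, a, _, _, _, _ => 𝟙 _
  | b, b, b, _, _, _, _ => 𝟙 _
  | o, o, a, _, _, _, _ => 𝟙 _
  | o, o, b, _, _, _, _ => 𝟙 _
  | o, a, a, _, _, k, _ => k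
  | o, b, b, _, _, k, _ => k

theorem cmp_assoc : ∀ {x y z t : Shape.{v', u'} K} (f : Hom K x y) (g : Hom K y z)
    (h : Hom K z t), cmp K (cmp K f g) h = cmp K f (cmp K g h) := by
  rintro (_ | _ | _) (_ | _ | _) (_ | _ | _) (_ | _ | _) f g h <;>
    first
    | rfl
    | exact PEmpty.elim f
    | exact PEmpty.elim g
    | exact PEmpty.elim h

theorem idd_cmp : ∀ {x y : Shape.{v', u'} K} (f : Hom K x y), cmp K (idd K x) f = f := by
  rintro (_ | _ | _) (_ | _ | _) f <;>
    first
    | rfl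
    | exact PEmpty.elim f

theorem cmp_idd : ∀ {x y : Shape.{v', u'} K} (f : Hom K x y), cmp K f (idd K y) = f := by
  rintro (_ | _ | _) (_ | _ | _) f <;>
    first
    | rfl
    | exact PEmpty.elim f

variable {K} in
theorem laux1 {x y : K} (f : x ⟶ y) : f = 𝟙 x ≫ f ≫ 𝟙 y := by simp

variable {K} in
theorem laux2 {x : K} : 𝟙 x = 𝟙 x ≫ 𝟙 x := by simp

variable {K} in
theorem laux3 (x : K) : 𝟙 x = 𝟙 x ≫ 𝟙 x ≫ 𝟙 x := by simp

variable {K} in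
theorem laux4 {x y : K} (f : x ⟶ y) : 𝟙 x ≫ f = f ≫ 𝟙 y := by simp

variable {K} in
theorem laux5 (x : K) : 𝟙 x ≫ 𝟙 x ≫ 𝟙 x = 𝟙 x ≫ 𝟙 x := by simp

variable {K} in
theorem laux6 (x : K) : 𝟙 x ≫ 𝟙 x = 𝟙 x := by simp

instance bicat : Bicategory.{w', v'} (Shape.{v', u'} K) where
  Hom x y := Hom K x y
  id x := idd K x
  comp f g := cmp K f g
  homCategory x y := homCat K x y
  whiskerLeft f _ _ η := wl K f η
  whiskerRight η h := wr K η h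
  associator f g h := eqToIso (cmp_assoc K f g h)
  leftUnitor f := eqToIso (idd_cmp K f)
  rightUnitor f := eqToIso (cmp_idd K f)
  whiskerLeft_id := by
    rintro (_ | _ | _) (_ | _ | _) (_ | _ | _) f g <;>
      first
      | exact PEmpty.elim f
      | exact PEmpty.elim g
      | rfl
  whiskerLeft_comp := by
    rintro (_ | _ | _) (_ | _ | _) (_ | _ | _) f g h i η θ <;>
      first
      | exact PEmpty.elim f
      | exact PEmpty.elim g
      | rfl
      | exact laux2 (K := K)
  id_whiskerLeft := by
    rintro (_ | _ | _) (_ | _ | _) f g η <;>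
      first
      | exact PEmpty.elim f
      | rfl
      | exact laux1 (K := K) η
  comp_whiskerLeft := by
    rintro (_ | _ | _) (_ | _ | _) (_ | _ | _) (_ | _ | _) f g h h' η <;>
      first
      | exact PEmpty.elim f
      | exact PEmpty.elim g
      | exact PEmpty.elim h
      | rfl
      | exact laux1 (K := K) η
      | exact laux3 (K := K) _
  id_whiskerRight := by
    rintro (_ | _ | _) (_ | _ | _) (_ | _ | _) f g <;>
      first
      | exact PEmpty.elim f
      | exact PEmpty.elim g
      | rfl
  comp_whiskerRight := by
    rintro (_ | _ | _) (_ | _ | _) (_ | _ | _) f g h η θ i <;>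
      first
      | exact PEmpty.elim f
      | exact PEmpty.elim i
      | rfl
      | exact laux2 (K := K)
  whiskerRight_id := by
    rintro (_ | _ | _) (_ | _ | _) f g η <;>
      first
      | exact PEmpty.elim f
      | rfl
      | exact laux1 (K := K) η
  whiskerRight_comp := by
    rintro (_ | _ | _) (_ | _ | _) (_ | _ | _) (_ | _ | _) f f' η g h <;>
      first
      | exact PEmpty.elim f
      | exact PEmpty.elim g
      | exact PEmpty.elim h
      | rfl
      | exact laux1 (K := K) η
      | exact laux3 (K := K) _
  whisker_assoc := by
    rintro (_ | _ | _) (_ | _ | _) (_ | _ | _) (_ | _ | _) f g g' η h <;>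
      first
      | exact PEmpty.elim f
      | exact PEmpty.elim g
      | exact PEmpty.elim h
      | rfl
      | exact laux1 (K := K) η
      | exact laux3 (K := K) _
  whisker_exchange := by
    rintro (_ | _ | _) (_ | _ | _) (_ | _ | _) f g h i η θ <;>
      first
      | exact PEmpty.elim f
      | exact PEmpty.elim h
      | rfl
      | exact laux4 (K := K) η
      | exact laux4 (K := K) θ
      | exact (laux4 (K := K) η).symm
      | exact (laux4 (K := K) θ).symm
  pentagon := by
    rintro (_ | _ | _) (_ | _ | _) (_ | _ | _) (_ | _ | _) (_ | _ | _) f g h i <;>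
      first
      | exact PEmpty.elim f
      | exact PEmpty.elim g
      | exact PEmpty.elim h
      | exact PEmpty.elim i
      | rfl
      | exact laux5 (K := K) _
  triangle := by
    rintro (_ | _ | _) (_ | _ | _) (_ | _ | _) f g <;>
      first
      | exact PEmpty.elim f
      | exact PEmpty.elim g
      | rfl
      | exact laux6 (K := K) _

variable {K}
variable {B : Type u} [Bicategory.{w, v} B] {X Y Z : B} (P : K ⥤ (X ⟶ Y)) (Q : K ⥤ (X ⟶ Z))

def fobj (X Y Z : B) : Shape.{v', u'} K → B
  | o => X
  | a => Y
  | b => Z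

def fmap : ∀ {x y : Shape.{v', u'} K}, Hom K x y → (fobj X Y Z x ⟶ fobj X Y Z y)
  | o, o, _ => 𝟙 _
  | a, a, _ => 𝟙 _
  | b, b, _ => 𝟙 _
  | o, a, k => P.obj k
  | o, b, k => Q.obj k

def fmap₂ : ∀ {x y : Shape.{v', u'} K} {f g : Hom K x y} (_ : f ⟶ g),
    fmap P Q f ⟶ fmap P Q g
  | o, o, _, _, _ => 𝟙 _
  | a, a, _, _, _ => 𝟙 _
  | b, b, _, _, _ => 𝟙 _
  | o, a, _, _, k => P.map k
  | o, b, _, _, k => Q.map k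

def fmapId : ∀ x : Shape.{v', u'} K, fmap P Q (idd K x) ≅ 𝟙 (fobj X Y Z x)
  | o => Iso.refl _
  | a => Iso.refl _
  | b => Iso.refl _

def fmapComp : ∀ {x y z : Shape.{v', u'} K} (f : Hom K x y) (g : Hom K y z),
    fmap P Q (cmp K f g) ≅ fmap P Q f ≫ fmap P Q g
  | o, o, o, _, _ => (λ_ (𝟙 X)).symm
  | a, a, a, _, _ => (λ_ (𝟙 Y)).symm
  | b, b, b, _, _ => (λ_ (𝟙 Z)).symm
  | o, o, a, _, k => (λ_ (P.obj k)).symm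
  | o, o, b, _, k => (λ_ (Q.obj k)).symm
  | o, a, a, k, _ => (ρ_ (P.obj k)).symm
  | o, b, b, k, _ => (ρ_ (Q.obj k)).symm

section
variable {X Y : B} {f g : X ⟶ Y}

theorem maux1 (η : f ⟶ g) : η = (λ_ f).inv ≫ 𝟙 X ◁ η ≫ (λ_ g).hom := by simp

theorem maux2 (f : X ⟶ Y) : 𝟙 f = (ρ_ f).inv ≫ f ◁ 𝟙 (𝟙 Y) ≫ (ρ_ f).hom := by simp

theorem maux3 (f : X ⟶ Y) : 𝟙 f = (λ_ f).inv ≫ 𝟙 (𝟙 X) ▷ f ≫ (λ_ f).hom := by simp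

theorem maux4 (η : f ⟶ g) : η = (ρ_ f).inv ≫ η ▷ 𝟙 Y ≫ (ρ_ g).hom := by simp

theorem maux5 (f : X ⟶ Y) : 𝟙 f = (λ_ f).inv ≫ (λ_ (𝟙 X)).inv ▷ f ≫ (α_ (𝟙 X) (𝟙 X) f).hom ≫
    𝟙 X ◁ (λ_ f).hom ≫ (λ_ f).hom := by bicategory

theorem maux6 (f : X ⟶ Y) : 𝟙 f = (ρ_ f).inv ≫ (λ_ f).inv ▷ 𝟙 Y ≫ (α_ (𝟙 X) f (𝟙 Y)).hom ≫
    𝟙 X ◁ (ρ_ f).hom ≫ (λ_ f).hom := by bicategory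

theorem maux7 (f : X ⟶ Y) : 𝟙 f = (ρ_ f).inv ≫ (ρ_ f).inv ▷ 𝟙 Y ≫ (α_ f (𝟙 Y) (𝟙 Y)).hom ≫
    f ◁ (λ_ (𝟙 Y)).hom ≫ (ρ_ f).hom := by bicategory

theorem maux8 (X : B) : 𝟙 (𝟙 X) = (λ_ (𝟙 X)).inv ≫ 𝟙 X ◁ 𝟙 (𝟙 X) ≫ (ρ_ (𝟙 X)).hom := by
  bicategory

end

def pf : Pseudofunctor (Shape.{v', u'} K) B where
  obj := fobj X Y Z
  map f := fmap P Q f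
  map₂ η := fmap₂ P Q η
  mapId x := fmapId P Q x
  mapComp f g := fmapComp P Q f g
  map₂_id := by
    rintro (_ | _ | _) (_ | _ | _) f <;>
      first
      | exact PEmpty.elim f
      | exact rfl
      | exact P.map_id f
      | exact Q.map_id f
  map₂_comp := by
    rintro (_ | _ | _) (_ | _ | _) f g h η θ <;>
      first
      | exact PEmpty.elim f
      | exact P.map_comp η θ
      | exact Q.map_comp η θ
      | exact (Category.id_comp _).symm
  map₂_whisker_left := by
    rintro (_ | _ | _) (_ | _ | _) (_ | _ | _) f g h η <;>
      first
      | exact PEmpty.elim f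
      | exact PEmpty.elim g
      | exact maux1 (P.map η)
      | exact maux1 (Q.map η)
      | exact maux1 (𝟙 (𝟙 _))
      | exact maux2 _
      | exact (P.map_id _).trans (maux2 _)
      | exact (Q.map_id _).trans (maux2 _)
  map₂_whisker_right := by
    rintro (_ | _ | _) (_ | _ | _) (_ | _ | _) f g η h <;>
      first
      | exact PEmpty.elim f
      | exact PEmpty.elim h
      | exact maux4 (P.map η)
      | exact maux4 (Q.map η)
      | exact maux3 _
      | exact (P.map_id _).trans (maux3 _)
      | exact (Q.map_id _).trans (maux3 _)
  map₂_associator := by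
    rintro (_ | _ | _) (_ | _ | _) (_ | _ | _) (_ | _ | _) f g h <;>
      first
      | exact PEmpty.elim f
      | exact PEmpty.elim g
      | exact PEmpty.elim h
      | exact maux5 _
      | exact maux6 _
      | exact maux7 _
      | exact (P.map_id _).trans (maux5 _)
      | exact (Q.map_id _).trans (maux5 _)
      | exact (P.map_id _).trans (maux6 _)
      | exact (Q.map_id _).trans (maux6 _)
      | exact (P.map_id _).trans (maux7 _)
      | exact (Q.map_id _).trans (maux7 _)
  map₂_left_unitor := by
    rintro (_ | _ | _) (_ | _ | _) f <;>
      first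
      | exact PEmpty.elim f
      | exact maux3 _
      | exact (P.map_id _).trans (maux3 _)
      | exact (Q.map_id _).trans (maux3 _)
  map₂_right_unitor := by
    rintro (_ | _ | _) (_ | _ | _) f <;>
      first
      | exact PEmpty.elim f
      | exact maux8 _
      | exact maux2 _
      | exact (P.map_id _).trans (maux2 _)
      | exact (Q.map_id _).trans (maux2 _)

theorem finiteBicategory [Finite K] [hK : ∀ x y : K, Finite (x ⟶ y)] :
    FiniteBicategory (Shape.{v', u'} K) := by
  refine ⟨?_, ?_, ?_⟩
  · refine Finite.of_surjective (fun i : Fin 3 => match i with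
      | 0 => (o : Shape.{v', u'} K)
      | 1 => a
      | 2 => b) ?_
    rintro (_ | _ | _)
    exacts [⟨0, rfl⟩, ⟨1, rfl⟩, ⟨2, rfl⟩]
  · rintro (_ | _ | _) (_ | _ | _) <;>
      first
      | exact ‹Finite K›
      | exact (inferInstance : Finite PUnit.{_ + 1})
      | exact (inferInstance : Finite PEmpty.{_ + 1})
  · rintro (_ | _ | _) (_ | _ | _) f g <;>
      first
      | exact (inferInstance : Finite PUnit.{_ + 1})
      | exact hK f g
      | exact PEmpty.elim f

theorem connectedBicategory [Nonempty K] : ConnectedBicategory (Shape.{v', u'} K) := by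
  obtain ⟨k⟩ := ‹Nonempty K›
  have h1 : ∀ x : Shape.{v', u'} K, Relation.ReflTransGen
      (fun x y : Shape.{v', u'} K => Nonempty (x ⟶ y) ∨ Nonempty (y ⟶ x)) o x := by
    rintro (_ | _ | _)
    · exact .refl
    · exact .single (.inl ⟨(k : Hom K o a)⟩)
    · exact .single (.inl ⟨(k : Hom K o b)⟩)
  have h2 : ∀ x : Shape.{v', u'} K, Relation.ReflTransGen
      (fun x y : Shape.{v', u'} K => Nonempty (x ⟶ y) ∨ Nonempty (y ⟶ x)) x o := by
    rintro (_ | _ | _)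
    · exact .refl
    · exact .single (.inr ⟨(k : Hom K o a)⟩)
    · exact .single (.inr ⟨(k : Hom K o b)⟩)
  exact fun x y => (h2 x).trans (h1 y)

/-- What a pseudofiltered bicategory gives for our shape. -/
theorem consequence (P : K ⥤ (X ⟶ Y)) (Q : K ⥤ (X ⟶ Z))
    (hB : IsPseudofiltered.{w, v, u, w', v', u'} B) [Finite K] [Nonempty K]
    [∀ x y : K, Finite (x ⟶ y)] :
    ∃ (E : B) (r : Y ⟶ E) (_ : Z ⟶ E) (t : X ⟶ E) (n : ∀ k, P.obj k ≫ r ≅ t),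
      ∀ {k l : K} (γ : k ⟶ l), P.map γ ▷ r ≫ (n l).hom = (n k).hom := by
  obtain ⟨E, ⟨c⟩⟩ := hB (Shape.{v', u'} K) finiteBicategory connectedBicategory (pf P Q)
  exact ⟨E, c.app a, c.app b, c.app o, fun k => c.nat (A := o) (A' := a) (k : Hom K o a),
    fun {k l} γ => c.nat2 (A := o) (A' := a) (f := (k : Hom K o a)) (g := (l : Hom K o a)) γ⟩

end Shape

/-- Walking parallel pair in arbitrary universes. -/
inductive WP : Type v'
  | s
  | t

namespace WP

def Hom : WP.{v'} → WP.{v'} → Type w'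
  | s, s => PUnit
  | t, t => PUnit
  | s, t => ULift Bool
  | t, s => PEmpty

instance : Category.{w'} WP.{v'} where
  Hom := Hom
  id
    | s => ⟨⟩
    | t => ⟨⟩
  comp {x y z} f g := match x, y, z, f, g with
    | s, s, s, _, _ => ⟨⟩
    | t, t, t, _, _ => ⟨⟩
    | s, s, t, _, k => k
    | s, t, t, k, _ => k
  id_comp := by
    rintro (_ | _) (_ | _) f <;> first | rfl | exact PEmpty.elim f
  comp_id := by
    rintro (_ | _) (_ | _) f <;> first | rfl | exact PEmpty.elim f
  assoc := by
    rintro (_ | _) (_ | _) (_ | _) (_ | _) f g h <;>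
      first
      | exact PEmpty.elim f
      | exact PEmpty.elim g
      | exact PEmpty.elim h
      | rfl

instance : Finite WP.{v'} :=
  Finite.of_surjective (fun i : Bool => if i then s else t) (by
    rintro (_ | _)
    exacts [⟨true, rfl⟩, ⟨false, rfl⟩])

instance : Nonempty WP.{v'} := ⟨s⟩

instance : ∀ x y : WP.{v'}, Finite (x ⟶ y) := by
  rintro (_ | _) (_ | _)
  · exact (inferInstance : Finite PUnit.{_ + 1})
  · exact (inferInstance : Finite (ULift Bool))
  · exact (inferInstance : Finite PEmpty.{_ + 1})
  · exact (inferInstance : Finite PUnit.{_ + 1})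

/-- The functor picked out by two parallel arrows. -/
def func {D : Type*} [Category D] {f g : D} (α β : f ⟶ g) : WP.{v'} ⥤ D where
  obj
    | s => f
    | t => g
  map {x y} k := match x, y, k with
    | s, s, _ => 𝟙 _
    | t, t, _ => 𝟙 _
    | s, t, k => if k.down then α else β
  map_id := by rintro (_ | _) <;> rfl
  map_comp := by
    rintro (_ | _) (_ | _) (_ | _) f g <;>
      first
      | exact PEmpty.elim f
      | exact PEmpty.elim g
      | exact (Category.id_comp _).symm
      | exact (Category.comp_id _).symm

end WP

/-- A discrete two-object category in arbitrary universes. -/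
inductive DP : Type v'
  | s
  | t

namespace DP

instance : Category.{w'} DP.{v'} where
  Hom x y := ULift (PLift (x = y))
  id _ := ⟨⟨rfl⟩⟩
  comp f g := ⟨⟨f.down.down.trans g.down.down⟩⟩

instance : Finite DP.{v'} :=
  Finite.of_surjective (fun i : Bool => if i then s else t) (by
    rintro (_ | _)
    exacts [⟨true, rfl⟩, ⟨false, rfl⟩])

instance : Nonempty DP.{v'} := ⟨s⟩

instance : ∀ x y : DP.{v'}, Finite (x ⟶ y) := fun x y =>
  (inferInstance : Finite (ULift (PLift (x = y))))

/-- The functor picked out by two objects. -/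
def func {D : Type*} [Category D] (f g : D) : DP.{v'} ⥤ D where
  obj
    | s => f
    | t => g
  map k := eqToHom (by rw [k.down.down])
  map_id := by intros; rfl
  map_comp := by intros; simp

end DP

end Backward

/-- A non-empty bicategory `B` is pseudofiltered if and only if it satisfies the three axioms
(0-pFlt), (1-pFlt) and (2-pFlt). -/
theorem pseudofiltered_iff_axioms (B : Type u) [Bicategory.{w, v} B] [Nonempty B] :
    IsPseudofiltered.{w, v, u, w', v', u'} B ↔ PFlt0 B ∧ PFlt1 B ∧ PFlt2 B := by
  constructor
  · intro hB
    refine ⟨?_, ?_, ?_⟩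
    · intro X Y Z f g
      obtain ⟨E, r, q, -⟩ := Shape.consequence (K := DP.{v'}) (DP.func f f) (DP.func g g) hB
      exact ⟨E, r, q, trivial⟩
    · intro X Y f g
      obtain ⟨E, r, -, t, n, -⟩ :=
        Shape.consequence (K := DP.{v'}) (DP.func f g) (DP.func f g) hB
      exact ⟨E, r, (n .s).hom ≫ (n .t).inv, trivial⟩
    · intro X Y f g α β
      obtain ⟨E, r, -, t, n, h⟩ :=
        Shape.consequence (K := WP.{v'}) (WP.func α β) (WP.func α β) hB
      have h1 : α ▷ r ≫ (n .t).hom = (n .s).hom :=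
        h (k := .s) (l := .t) (ULift.up true : WP.Hom .s .t)
      have h2 : β ▷ r ≫ (n .t).hom = (n .s).hom :=
        h (k := .s) (l := .t) (ULift.up false : WP.Hom .s .t)
      exact ⟨E, r, (cancel_mono (n .t).hom).1 (h1.trans h2.symm)⟩
  · rintro ⟨h0, h1, h2⟩ C _ hfin hconn F
    by_cases hC : Nonempty C
    · have := hfin.1
      obtain ⟨P⟩ := exists_leg h0 hconn F
      obtain ⟨Q⟩ := exists_preCocone h1 h2 hfin P
      exact exists_pseudoCocone h2 hfin Q
    · rw [not_nonempty_iff] at hC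
      obtain ⟨E⟩ := ‹Nonempty B›
      exact ⟨E, ⟨{
        app := fun A => isEmptyElim A
        nat := fun {A} => isEmptyElim A
        unity := fun A => isEmptyElim A
        comp := fun {A} => isEmptyElim A
        nat2 := fun {A} => (IsEmpty.false A).elim }⟩⟩

end Paper
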